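/- arXiv:0812.4861 — 6 statements merged into one kernel-verified Lean document; each statement's English description precedes it below -/
import Mathlib

section
/- Let π = (5^2, 4^i, 3^j, 2^{n−2−i−j}) where n ≥ 6, i, j ≥ 0, i + j ≥ 4, i + j ≤ n − 2, and σ(π) is even. Then π is potentially K6−C5-graphic if and only if π is none of the sequences (5^2, 3^4), (5^2, 3^4, 2), (5^2, 3^6), (5^2, 4, 3^4). -/
/-- The degree of vertex `i` in the simple graph `G`. -/
noncomputable def degCount {n : ℕ} (G : SimpleGraph (Fin n)) (i : Fin n) : ℕ :=
  {j | G.Adj i j}.ncard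

/-- The graph `K₆ − C₅`: the complete graph on 6 vertices minus the edges of a
cycle on 5 of its vertices.  Vertex `0` is adjacent to all other vertices, and the
vertices `1,…,5` carry the complement of a 5-cycle (which is again a 5-cycle).
Its degree sequence is `(5,3,3,3,3,3)`. -/
def K6C5 : SimpleGraph (Fin 6) :=
  SimpleGraph.fromRel (fun a b =>
    a = 0 ∨ b = 0 ∨
      (a, b) ∈ ([(1, 3), (3, 5), (5, 2), (2, 4), (4, 1)] : List (Fin 6 × Fin 6)))

/-- A list of natural numbers is graphic if it is the degree sequence of some
simple graph. -/
def IsGraphic (l : List ℕ) : Prop :=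
  ∃ G : SimpleGraph (Fin l.length), ∀ i : Fin l.length, degCount G i = l.get i

/-- A list of natural numbers is potentially `K₆ − C₅`-graphic if it has a
realization containing `K₆ − C₅` as a subgraph. -/
def PotentiallyK6C5 (l : List ℕ) : Prop :=
  ∃ G : SimpleGraph (Fin l.length),
    (∀ i : Fin l.length, degCount G i = l.get i) ∧
    ∃ f : Fin 6 → Fin l.length, Function.Injective f ∧
      ∀ a b : Fin 6, K6C5.Adj a b → G.Adj (f a) (f b)

open SimpleGraph

instance : DecidableRel K6C5.Adj :=
  inferInstanceAs (DecidableRel (SimpleGraph.fromRel _).Adj)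

/-- The multiset of vertex degrees of a finite graph. -/
noncomputable def degreeMultiset {V : Type*} [Fintype V] (G : SimpleGraph V) : Multiset ℕ :=
  Finset.univ.val.map fun v => (G.neighborSet v).ncard

/-- Two disjoint edges `ab`, `cd` together with an edge `uv` that avoids `a` and `c`. -/
def HasSpareEdges {V : Type*} (X : SimpleGraph V) : Prop :=
  ∃ a b c d u v, X.Adj a b ∧ X.Adj c d ∧ X.Adj u v ∧ a ≠ c ∧ a ≠ d ∧ b ≠ c ∧ b ≠ d ∧
    a ≠ u ∧ a ≠ v ∧ c ≠ u ∧ c ≠ v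

/-- The degree multiset `s` has a realization containing `K₆ − C₅`. -/
def Realizable (s : Multiset ℕ) : Prop :=
  ∃ (V : Type) (_ : Fintype V) (G : SimpleGraph V) (f : Fin 6 ↪ V),
    degreeMultiset G = s ∧ K6C5.map f ≤ G

/-- The degree multiset `s` has a realization containing `K₆ − C₅` with spare edges outside
the copy. -/
def Extendable (s : Multiset ℕ) : Prop :=
  ∃ (V : Type) (_ : Fintype V) (G : SimpleGraph V) (f : Fin 6 ↪ V),
    degreeMultiset G = s ∧ K6C5.map f ≤ G ∧ HasSpareEdges (G \ K6C5.map f)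

theorem Extendable.realizable {s : Multiset ℕ} (h : Extendable s) : Realizable s := by
  obtain ⟨V, hV, G, f, hs, hf, -⟩ := h
  exact ⟨V, hV, G, f, hs, hf⟩

theorem exists_equiv_of_map_univ_eq {α β γ : Type*} [Fintype α] [Fintype β] (f : α → γ)
    (g : β → γ) (h : Finset.univ.val.map f = Finset.univ.val.map g) :
    ∃ e : α ≃ β, ∀ a, g (e a) = f a := by
  classical
  have hc (c : γ) : Nonempty ({a // f a = c} ≃ {b // g b = c}) := by
    refine Fintype.card_eq.1 ?_
    have := congrArg (Multiset.count c) h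
    rw [Multiset.count_map, Multiset.count_map] at this
    simpa [Fintype.card_subtype, Finset.card_def, eq_comm] using this
  let e (c : γ) := (hc c).some
  refine ⟨(Equiv.sigmaFiberEquiv f).symm.trans
    ((Equiv.sigmaCongrRight e).trans (Equiv.sigmaFiberEquiv g)), fun a => ?_⟩
  exact (e (f a) ⟨a, rfl⟩).2

theorem Realizable.potentiallyK6C5 {l : List ℕ} (h : Realizable l) : PotentiallyK6C5 l := by
  obtain ⟨V, hV, G, f, hs, hf⟩ := h
  have hl : (l : Multiset ℕ) = Finset.univ.val.map l.get := by
    rw [Fin.univ_val_map, List.ofFn_get]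
  obtain ⟨φ, hφ⟩ := exists_equiv_of_map_univ_eq _ _ (hs.trans hl)
  refine ⟨G.map φ.toEmbedding, fun x => ?_, φ ∘ f, φ.injective.comp f.injective,
    fun a b hab => ?_⟩
  · have h1 : {y | (G.map φ.toEmbedding).Adj x y} = φ '' G.neighborSet (φ.symm x) := by
      ext y
      constructor
      · rintro ⟨-, u, v, huv, rfl, rfl⟩
        exact ⟨v, by simpa using huv, rfl⟩
      · rintro ⟨v, hv, rfl⟩
        rw [mem_neighborSet] at hv
        exact (map_adj ..).2 ⟨φ.symm x, v, hv, by simp, rfl⟩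
    rw [degCount, h1, Set.ncard_image_of_injective _ φ.injective]
    simpa using (hφ (φ.symm x)).symm
  · exact (map_adj ..).2 ⟨f a, f b, hf ((map_adj ..).2 ⟨a, b, hab, rfl, rfl⟩), rfl, rfl⟩

theorem univ_option_val (V : Type*) [Fintype V] :
    (Finset.univ : Finset (Option V)).val = none ::ₘ Finset.univ.val.map some := rfl

section Pinch

variable {V : Type*}

/-- Delete the edges of `M` and join a new vertex to all vertices incident with `M`. -/
def pinch (G M : SimpleGraph V) : SimpleGraph (Option V) where
  Adj
    | some u, some v => G.Adj u v ∧ ¬ M.Adj u v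
    | none, some v => ∃ w, M.Adj v w
    | some v, none => ∃ w, M.Adj v w
    | none, none => False
  symm := ⟨by
    rintro (_ | u) (_ | v) h
    · exact h
    · exact h
    · exact h
    · exact ⟨h.1.symm, fun h' => h.2 h'.symm⟩⟩
  loopless := ⟨by
    rintro (_ | u) h
    · exact h
    · exact h.1.ne rfl⟩

variable {G M C : SimpleGraph V}

theorem ncard_neighborSet_pinch_some (hMG : M ≤ G)
    (hM : ∀ u v w, M.Adj u v → M.Adj u w → v = w) (v : V) :
    ((pinch G M).neighborSet (some v)).ncard = (G.neighborSet v).ncard := by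
  classical
  have h : (pinch G M).neighborSet (some v) =
      (fun u => if M.Adj v u then none else some u) '' G.neighborSet v := by
    ext (_ | w)
    · constructor
      · rintro ⟨u, hu⟩
        exact ⟨u, hMG hu, if_pos hu⟩
      · rintro ⟨u, -, hu⟩
        by_cases huv : M.Adj v u
        · exact ⟨u, huv⟩
        · simp [huv] at hu
    · constructor
      · rintro ⟨h1, h2⟩
        exact ⟨w, h1, if_neg h2⟩
      · rintro ⟨u, hu, huw⟩
        by_cases huv : M.Adj v u
        · simp [huv] at huw
        · simp only [huv, if_false, Option.some.injEq] at huw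
          subst huw
          exact ⟨hu, huv⟩
  rw [h]
  refine Set.InjOn.ncard_image fun x _ y _ hxy => ?_
  by_cases h1 : M.Adj v x <;> by_cases h2 : M.Adj v y <;> simp [h1, h2] at hxy
  · exact hM v x y h1 h2
  · exact hxy

theorem ncard_neighborSet_pinch_none :
    ((pinch G M).neighborSet none).ncard = M.support.ncard := by
  have h : (pinch G M).neighborSet none = some '' M.support := by
    ext (_ | w)
    · simp [pinch]
    · simp [pinch, SimpleGraph.mem_support]
  rw [h, Set.ncard_image_of_injective _ (Option.some_injective _)]

theorem degreeMultiset_pinch [Fintype V] (hMG : M ≤ G)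
    (hM : ∀ u v w, M.Adj u v → M.Adj u w → v = w) :
    degreeMultiset (pinch G M) = M.support.ncard ::ₘ degreeMultiset G := by
  simp [degreeMultiset, univ_option_val, ncard_neighborSet_pinch_none, ncard_neighborSet_pinch_some hMG hM]

theorem map_some_le_pinch (hC : C ≤ G) (hM : M ≤ G \ C) :
    C.map Function.Embedding.some ≤ pinch G M := by
  rintro _ _ ⟨-, u, v, h, rfl, rfl⟩
  exact ⟨hC h, fun h' => (hM h').2 h⟩

theorem pinch_sdiff_adj_some {u v : V} (h : (G \ C).Adj u v) (hM : ¬ M.Adj u v) :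
    (pinch G M \ C.map Function.Embedding.some).Adj (some u) (some v) := by
  refine ⟨⟨h.1, hM⟩, ?_⟩
  rintro ⟨-, u', v', h', hu, hv⟩
  cases hu
  cases hv
  exact h.2 h'

theorem pinch_sdiff_adj_none {u v : V} (h : M.Adj u v) :
    (pinch G M \ C.map Function.Embedding.some).Adj (some u) none := by
  refine ⟨⟨v, h⟩, ?_⟩
  rintro ⟨-, u', v', h', hu, hv⟩
  cases hv

end Pinch

theorem K6C5_map_trans_some {V : Type*} (f : Fin 6 ↪ V) :
    K6C5.map (f.trans Function.Embedding.some) =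
      (K6C5.map f).map Function.Embedding.some :=
  (SimpleGraph.map_map K6C5 f Function.Embedding.some).symm

theorem support_edge {V : Type*} {a b : V} (h : a ≠ b) : (edge a b).support = {a, b} := by
  ext x
  simp only [SimpleGraph.mem_support, edge_adj, Set.mem_insert_iff, Set.mem_singleton_iff]
  constructor
  · rintro ⟨w, hw, -⟩
    tauto
  · rintro (rfl | rfl)
    · exact ⟨b, by tauto⟩
    · exact ⟨a, by tauto⟩

theorem edge_adj_unique {V : Type*} {a b u v w : V} (h₁ : (edge a b).Adj u v)
    (h₂ : (edge a b).Adj u w) : v = w := by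
  rw [edge_adj] at h₁ h₂
  grind

theorem degreeMultiset_pinch_edge {V : Type*} [Fintype V] {G : SimpleGraph V} {a b : V}
    (h : G.Adj a b) : degreeMultiset (pinch G (edge a b)) = 2 ::ₘ degreeMultiset G := by
  rw [degreeMultiset_pinch ((edge_le_iff ..).2 (.inr h)) fun _ _ _ => edge_adj_unique,
    support_edge h.ne, Set.ncard_pair h.ne]

theorem Extendable.cons_two {s : Multiset ℕ} (h : Extendable s) : Extendable (2 ::ₘ s) := by
  obtain ⟨V, hV, G, f, rfl, hf, a, b, c, d, u, v, hab, hcd, huv, hac, had, hbc, hbd, hau, hav,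
    hcu, hcv⟩ := h
  refine ⟨Option V, inferInstance, pinch G (edge a b), f.trans .some,
    degreeMultiset_pinch_edge hab.1, ?_, ?_⟩
  · rw [K6C5_map_trans_some]
    exact map_some_le_pinch hf ((edge_le_iff ..).2 (.inr hab))
  · rw [K6C5_map_trans_some]
    refine ⟨some a, none, some c, some d, some u, some v, pinch_sdiff_adj_none (v := b) ?_,
      pinch_sdiff_adj_some hcd ?_, pinch_sdiff_adj_some huv ?_, ?_⟩
    · exact (edge_adj ..).2 ⟨by tauto, hab.ne⟩
    · rw [edge_adj]; grind
    · rw [edge_adj]; grind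
    · simp [*]

theorem Extendable.cons_four {s : Multiset ℕ} (h : Extendable s) : Extendable (4 ::ₘ s) := by
  obtain ⟨V, hV, G, f, rfl, hf, a, b, c, d, u, v, hab, hcd, huv, hac, had, hbc, hbd, hau, hav,
    hcu, hcv⟩ := h
  have hle : edge a b ⊔ edge c d ≤ G \ K6C5.map f :=
    sup_le ((edge_le_iff ..).2 (.inr hab)) ((edge_le_iff ..).2 (.inr hcd))
  refine ⟨Option V, inferInstance, pinch G (edge a b ⊔ edge c d), f.trans .some, ?_, ?_, ?_⟩
  · rw [degreeMultiset_pinch (hle.trans sdiff_le)]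
    · congr 1
      have : (edge a b ⊔ edge c d).support = {a, b, c, d} := by
        have h1 : (edge a b ⊔ edge c d).support = (edge a b).support ∪ (edge c d).support := by
          ext x
          simp [SimpleGraph.mem_support, exists_or]
        rw [h1, support_edge hab.ne, support_edge hcd.ne]
        ext x
        simp only [Set.mem_union, Set.mem_insert_iff, Set.mem_singleton_iff, or_assoc]
      classical
      rw [this]
      have h2 : ({a, b, c, d} : Set V) = (({a, b, c, d} : Finset V) : Set V) := by simp
      rw [h2, Set.ncard_coe_finset]
      have := hab.ne
      have := hcd.ne
      simp [*]
    · intro x y z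
      simp only [sup_adj, edge_adj]
      grind
  · rw [K6C5_map_trans_some]
    exact map_some_le_pinch hf hle
  · rw [K6C5_map_trans_some]
    refine ⟨some a, none, some u, some v, some c, none, pinch_sdiff_adj_none (v := b) ?_,
      pinch_sdiff_adj_some huv ?_, pinch_sdiff_adj_none (v := d) ?_, ?_⟩
    · exact .inl ((edge_adj ..).2 ⟨by tauto, hab.ne⟩)
    · simp only [sup_adj, edge_adj]; grind
    · exact .inr ((edge_adj ..).2 ⟨by tauto, hcd.ne⟩)
    · simp [*, Ne.symm]

theorem ncard_neighborSet_sup_edge {V : Type*} [Finite V] {G : SimpleGraph V} {x y : V}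
    (hxy : x ≠ y) (h : ¬ G.Adj x y) :
    ((G ⊔ edge x y).neighborSet x).ncard = (G.neighborSet x).ncard + 1 := by
  have : (G ⊔ edge x y).neighborSet x = insert y (G.neighborSet x) := by
    ext z
    simp only [mem_neighborSet, sup_adj, edge_adj, Set.mem_insert_iff]
    grind
  rw [this, Set.ncard_insert_of_notMem (s := G.neighborSet x) h (Set.toFinite _)]

theorem neighborSet_sup_edge_of_ne {V : Type*} {G : SimpleGraph V} {x y z : V}
    (hx : z ≠ x) (hy : z ≠ y) : (G ⊔ edge x y).neighborSet z = G.neighborSet z := by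
  ext w
  simp only [mem_neighborSet, sup_adj, edge_adj]
  grind

theorem Extendable.cons_three_three {s : Multiset ℕ} (h : Extendable s) :
    Extendable (3 ::ₘ 3 ::ₘ s) := by
  obtain ⟨V, hV, G, f, rfl, hf, a, b, c, d, u, v, hab, hcd, huv, hac, had, hbc, hbd, hau, hav,
    hcu, hcv⟩ := h
  let G₁ := pinch G (edge a b)
  let G₂ := pinch G₁ (edge (some c) (some d))
  let K₁ := (K6C5.map f).map Function.Embedding.some
  let K₂ := K₁.map Function.Embedding.some
  have hcd₁ : (G₁ \ K₁).Adj (some c) (some d) :=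
    pinch_sdiff_adj_some hcd (by rw [edge_adj]; grind)
  have huv₁ : (G₁ \ K₁).Adj (some u) (some v) :=
    pinch_sdiff_adj_some huv (by rw [edge_adj]; grind)
  have hax₁ : (G₁ \ K₁).Adj (some a) none :=
    pinch_sdiff_adj_none (v := b) ((edge_adj ..).2 ⟨by tauto, hab.ne⟩)
  have hle₁ : K₁ ≤ G₁ := map_some_le_pinch hf ((edge_le_iff ..).2 (.inr hab))
  have hle₂ : K₂ ≤ G₂ := map_some_le_pinch hle₁ ((edge_le_iff ..).2 (.inr hcd₁))
  have huv₂ : (G₂ \ K₂).Adj (some (some u)) (some (some v)) :=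
    pinch_sdiff_adj_some huv₁ (by rw [edge_adj]; grind)
  have hax₂ : (G₂ \ K₂).Adj (some (some a)) (some none) :=
    pinch_sdiff_adj_some hax₁ (by rw [edge_adj]; grind)
  have hcy₂ : (G₂ \ K₂).Adj (some (some c)) none :=
    pinch_sdiff_adj_none (v := some d) ((edge_adj ..).2 ⟨by tauto, hcd₁.ne⟩)
  have hxy : ¬ G₂.Adj none (some none) := by
    rintro ⟨w, hw⟩
    rw [edge_adj] at hw
    grind
  have hK : K6C5.map ((f.trans .some).trans .some) = K₂ := by
    rw [K6C5_map_trans_some, K6C5_map_trans_some]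
  have hmono : G₂ \ K₂ ≤ (G₂ ⊔ edge none (some none)) \ K₂ := sdiff_le_sdiff_right le_sup_left
  have hle : edge a b ≤ G := (edge_le_iff ..).2 (.inr hab.1)
  have hle' : edge (some c) (some d) ≤ G₁ := (edge_le_iff ..).2 (.inr hcd₁.1)
  refine ⟨Option (Option V), inferInstance, G₂ ⊔ edge none (some none),
    (f.trans .some).trans .some, ?_, ?_, ?_⟩
  · have h₁ : ((G₂ ⊔ edge none (some none)).neighborSet none).ncard = 3 := by
      rw [ncard_neighborSet_sup_edge (by simp) hxy, ncard_neighborSet_pinch_none,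
        support_edge hcd₁.ne, Set.ncard_pair hcd₁.ne]
    have h₂ : ((G₂ ⊔ edge none (some none)).neighborSet (some none)).ncard = 3 := by
      rw [edge_comm, ncard_neighborSet_sup_edge (by simp) fun h => hxy h.symm,
        ncard_neighborSet_pinch_some hle' fun _ _ _ => edge_adj_unique,
        ncard_neighborSet_pinch_none, support_edge hab.ne, Set.ncard_pair hab.ne]
    have h₃ (z : V) : ((G₂ ⊔ edge none (some none)).neighborSet (some (some z))).ncard =
        (G.neighborSet z).ncard := by
      rw [neighborSet_sup_edge_of_ne (by simp) (by simp),
        ncard_neighborSet_pinch_some hle' fun _ _ _ => edge_adj_unique,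
        ncard_neighborSet_pinch_some hle fun _ _ _ => edge_adj_unique]
    simp only [degreeMultiset, univ_option_val, Multiset.map_cons, Multiset.map_map,
      Function.comp_apply, h₁, h₂, h₃]
  · rw [hK]
    exact hle₂.trans le_sup_left
  · rw [hK]
    refine ⟨_, _, _, _, _, _, hmono hax₂, hmono hcy₂, hmono huv₂, ?_⟩
    simp [*]

/-- The multiset `(5², 4ⁱ, 3ʲ, 2ᵏ)`. -/
def degs (i j k : ℕ) : Multiset ℕ :=
  Multiset.replicate 2 5 + Multiset.replicate i 4 + Multiset.replicate j 3 +
    Multiset.replicate k 2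

theorem Extendable.degs_add {i j k : ℕ} (h : Extendable (degs i j k)) (p q r : ℕ) :
    Extendable (degs (i + p) (j + 2 * q) (k + r)) := by
  induction p with
  | succ p ih =>
    have : degs (i + (p + 1)) (j + 2 * q) (k + r) =
        4 ::ₘ degs (i + p) (j + 2 * q) (k + r) := by
      simp [degs, ← add_assoc, Multiset.replicate_succ]
    exact this ▸ ih.cons_four
  | zero =>
    induction q with
    | succ q ih =>
      have : degs (i + 0) (j + 2 * (q + 1)) (k + r) =
          3 ::ₘ 3 ::ₘ degs (i + 0) (j + 2 * q) (k + r) := by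
        simp [degs, mul_add, ← add_assoc, Multiset.replicate_succ]
      exact this ▸ ih.cons_three_three
    | zero =>
      induction r with
      | succ r ih =>
        have : degs (i + 0) (j + 2 * 0) (k + (r + 1)) =
            2 ::ₘ degs (i + 0) (j + 2 * 0) (k + r) := by
          simp [degs, ← add_assoc, Multiset.replicate_succ]
        exact this ▸ ih.cons_two
      | zero => exact h

section SmallCases

/-- A copy of `K₆ − C₅` on the vertices `0, …, 5` of `Fin (m + 6)`. -/
def smallCopy (m : ℕ) : SimpleGraph (Fin (m + 6)) :=
  K6C5.map (Fin.castLEEmb (Nat.le_add_left 6 m))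

instance (m : ℕ) : DecidableRel (smallCopy m).Adj :=
  fun _ _ => decidable_of_iff' _ (map_adj ..)

/-- The graph on `Fin (m + 6)` consisting of `smallCopy m` and the edges in `E`. -/
def smallGraph (m : ℕ) (E : List (Fin (m + 6) × Fin (m + 6))) : SimpleGraph (Fin (m + 6)) :=
  smallCopy m ⊔ SimpleGraph.fromRel fun a b => (a, b) ∈ E

instance (m : ℕ) (E : List (Fin (m + 6) × Fin (m + 6))) : DecidableRel (smallGraph m E).Adj :=
  fun _ _ => decidable_of_iff' _ (sup_adj ..)

theorem degreeMultiset_eq_map_card {V : Type*} [Fintype V] (G : SimpleGraph V)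
    [DecidableRel G.Adj] :
    degreeMultiset G = Finset.univ.val.map fun v => (Finset.univ.filter (G.Adj v)).card := by
  refine Multiset.map_congr rfl fun v _ => ?_
  rw [← Set.ncard_coe_finset]
  congr 1
  ext w
  simp

theorem realizable_smallGraph {s : Multiset ℕ} (m : ℕ) (E : List (Fin (m + 6) × Fin (m + 6)))
    (hs : (Finset.univ.val.map fun v =>
      (Finset.univ.filter ((smallGraph m E).Adj v)).card) = s) : Realizable s :=
  ⟨_, inferInstance, smallGraph m E, _, (degreeMultiset_eq_map_card _).trans hs, le_sup_left⟩

theorem extendable_smallGraph {s : Multiset ℕ} (m : ℕ) (E : List (Fin (m + 6) × Fin (m + 6)))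
    (a b c d u v : Fin (m + 6))
    (hs : (Finset.univ.val.map fun v =>
      (Finset.univ.filter ((smallGraph m E).Adj v)).card) = s)
    (h : ((smallGraph m E).Adj a b ∧ ¬ (smallCopy m).Adj a b) ∧
      ((smallGraph m E).Adj c d ∧ ¬ (smallCopy m).Adj c d) ∧
      ((smallGraph m E).Adj u v ∧ ¬ (smallCopy m).Adj u v) ∧
      a ≠ c ∧ a ≠ d ∧ b ≠ c ∧ b ≠ d ∧ a ≠ u ∧ a ≠ v ∧ c ≠ u ∧ c ≠ v) : Extendable s :=
  ⟨_, inferInstance, smallGraph m E, _, (degreeMultiset_eq_map_card _).trans hs, le_sup_left,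
    a, b, c, d, u, v, h⟩

theorem realizable_two_two_zero : Realizable (degs 2 2 0) :=
  realizable_smallGraph 0 [(1, 2), (2, 3)] (by decide +kernel)

theorem realizable_zero_four_two : Realizable (degs 0 4 2) :=
  realizable_smallGraph 2 [(2, 6), (6, 7), (7, 2)] (by decide +kernel)

theorem extendable_four_zero_zero : Extendable (degs 4 0 0) :=
  extendable_smallGraph 0 [(1, 2), (2, 3), (4, 5)] 1 2 4 5 2 3
    (by decide +kernel) (by decide +kernel)

theorem extendable_two_two_one : Extendable (degs 2 2 1) :=
  extendable_smallGraph 1 [(1, 2), (2, 6), (6, 3)] 1 2 3 6 2 6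
    (by decide +kernel) (by decide +kernel)

theorem extendable_three_two_zero : Extendable (degs 3 2 0) :=
  extendable_smallGraph 1 [(2, 1), (2, 6), (6, 3), (6, 4)] 1 2 3 6 6 4
    (by decide +kernel) (by decide +kernel)

theorem extendable_two_four_zero : Extendable (degs 2 4 0) :=
  extendable_smallGraph 2 [(6, 7), (2, 6), (2, 7), (6, 1), (7, 3)] 1 6 3 7 2 6
    (by decide +kernel) (by decide +kernel)

theorem extendable_zero_four_three : Extendable (degs 0 4 3) :=
  extendable_smallGraph 3 [(2, 6), (6, 7), (7, 8), (8, 2)] 2 6 8 7 6 7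
    (by decide +kernel) (by decide +kernel)

theorem extendable_one_four_one : Extendable (degs 1 4 1) :=
  extendable_smallGraph 2 [(6, 2), (6, 1), (6, 7), (7, 2)] 1 6 7 2 6 2
    (by decide +kernel) (by decide +kernel)

theorem extendable_zero_six_one : Extendable (degs 0 6 1) :=
  extendable_smallGraph 3 [(6, 7), (6, 2), (6, 8), (7, 2), (7, 8)] 2 6 8 7 6 7
    (by decide +kernel) (by decide +kernel)

theorem extendable_one_six_zero : Extendable (degs 1 6 0) :=
  extendable_smallGraph 3 [(1, 6), (6, 7), (6, 8), (7, 8), (2, 7), (2, 8)] 1 6 2 7 7 8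
    (by decide +kernel) (by decide +kernel)

theorem extendable_zero_eight_zero : Extendable (degs 0 8 0) :=
  extendable_smallGraph 4 [(2, 6), (2, 7), (6, 8), (6, 9), (7, 8), (7, 9), (8, 9)] 2 6 8 7 6 9
    (by decide +kernel) (by decide +kernel)

end SmallCases

theorem Extendable.realizable_degs {i j k i' j' k' : ℕ} (h : Extendable (degs i' j' k'))
    (hi : i' ≤ i) (hj : j' ≤ j) (hj₂ : Even (j - j')) (hk : k' ≤ k) :
    Realizable (degs i j k) := by
  obtain ⟨q, hq⟩ := hj₂
  have := (h.degs_add (i - i') q (k - k')).realizable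
  rwa [show i' + (i - i') = i by lia, show j' + 2 * q = j by lia,
    show k' + (k - k') = k by lia] at this

theorem realizable_degs {i j k : ℕ} (hj : Even j) (hij : 4 ≤ i + j)
    (h₁ : ¬ (i = 0 ∧ j = 4 ∧ k = 0)) (h₂ : ¬ (i = 0 ∧ j = 4 ∧ k = 1))
    (h₃ : ¬ (i = 0 ∧ j = 6 ∧ k = 0)) (h₄ : ¬ (i = 1 ∧ j = 4 ∧ k = 0)) :
    Realizable (degs i j k) := by
  have heven (j' : ℕ) (h : Even j') (hle : j' ≤ j) : Even (j - j') :=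
    (Nat.even_sub hle).2 (by tauto)
  obtain rfl | hj2 : j = 0 ∨ 2 ≤ j := by grind
  · exact extendable_four_zero_zero.realizable_degs (by lia) le_rfl (by simp) (by lia)
  by_cases h22 : i = 2 ∧ j = 2 ∧ k = 0
  · obtain ⟨rfl, rfl, rfl⟩ := h22
    exact realizable_two_two_zero
  by_cases h04 : i = 0 ∧ j = 4 ∧ k = 2
  · obtain ⟨rfl, rfl, rfl⟩ := h04
    exact realizable_zero_four_two
  have key {i' j' k' : ℕ} (h : Extendable (degs i' j' k')) (he : Even j')
      (hle : i' ≤ i ∧ j' ≤ j ∧ k' ≤ k) : Realizable (degs i j k) :=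
    h.realizable_degs hle.1 hle.2.1 (heven _ he hle.2.1) hle.2.2
  have : (2 ≤ i ∧ 1 ≤ k) ∨ 3 ≤ i ∨ (2 ≤ i ∧ 4 ≤ j) ∨ (4 ≤ j ∧ 3 ≤ k) ∨
      (1 ≤ i ∧ 4 ≤ j ∧ 1 ≤ k) ∨ (6 ≤ j ∧ 1 ≤ k) ∨ (1 ≤ i ∧ 6 ≤ j) ∨ 8 ≤ j := by
    obtain ⟨t, rfl⟩ := hj
    omega
  rcases this with h | h | h | h | h | h | h | h
  · exact key extendable_two_two_one (by decide) (by lia)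
  · exact key extendable_three_two_zero (by decide) (by lia)
  · exact key extendable_two_four_zero (by decide) (by lia)
  · exact key extendable_zero_four_three (by decide) (by lia)
  · exact key extendable_one_four_one (by decide) (by lia)
  · exact key extendable_zero_six_one (by decide) (by lia)
  · exact key extendable_one_six_zero (by decide) (by lia)
  · exact key extendable_zero_eight_zero (by decide) (by lia)

/-- The degree at `x` of a copy of `K₆ − C₅` with vertex set `S` and centre `c`. -/
def copyDegree {N : ℕ} (S : Finset (Fin N)) (c x : Fin N) : ℕ :=
  if x = c then 5 else if x ∈ S then 3 else 0

theorem ncard_neighborSet_K6C5 (a : Fin 6) :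
    (K6C5.neighborSet a).ncard = if a = 0 then 5 else 3 := by
  have h : K6C5.neighborSet a = (Finset.univ.filter (K6C5.Adj a) : Finset (Fin 6)) := by
    ext; simp
  rw [h, Set.ncard_coe_finset]
  clear h
  revert a
  decide +kernel

theorem ncard_neighborSet_map_K6C5 {N : ℕ} (f : Fin 6 ↪ Fin N) (x : Fin N) :
    ((K6C5.map f).neighborSet x).ncard = copyDegree (Finset.univ.map f) (f 0) x := by
  by_cases hx : ∃ a, f a = x
  · obtain ⟨a, rfl⟩ := hx
    have : (K6C5.map f).neighborSet (f a) = f '' K6C5.neighborSet a := by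
      ext y
      simp
    rw [this, Set.ncard_image_of_injective _ f.injective, ncard_neighborSet_K6C5]
    simp [copyDegree]
  · have : (K6C5.map f).neighborSet x = ∅ := by
      ext y
      simp only [mem_neighborSet, map_adj, Set.mem_empty_iff_false, iff_false]
      rintro ⟨a, b, -, rfl, -⟩
      exact hx ⟨a, rfl⟩
    have h0 : x ≠ f 0 := fun h => hx ⟨0, h.symm⟩
    simpa [this, copyDegree, h0] using hx

/-- Each vertex has at most as many edges outside the copy as there are other vertices whose
degree exceeds their degree in the copy. -/
theorem PotentiallyK6C5.exists_copy {l : List ℕ} (h : PotentiallyK6C5 l) :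
    ∃ S ∈ Finset.univ.powersetCard 6, ∃ c ∈ S, ∀ x : Fin l.length,
      copyDegree S c x ≤ l.get x ∧ l.get x - copyDegree S c x ≤
        (Finset.univ.filter fun y => y ≠ x ∧ copyDegree S c y < l.get y).card := by
  obtain ⟨G, hG, f, hf, hadj⟩ := h
  let g : Fin 6 ↪ Fin l.length := ⟨f, hf⟩
  have hle : K6C5.map g ≤ G := by
    rintro _ _ ⟨-, a, b, hab, rfl, rfl⟩
    exact hadj a b hab
  have hdeg (x : Fin l.length) : (G.neighborSet x).ncard = l.get x := hG x
  have hsub (x : Fin l.length) : (K6C5.map g).neighborSet x ⊆ G.neighborSet x :=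
    fun y hy => hle hy
  refine ⟨Finset.univ.map g, by simp [Finset.mem_powersetCard], g 0, by simp, fun x => ?_⟩
  simp only [← ncard_neighborSet_map_K6C5, ← hdeg]
  refine ⟨Set.ncard_le_ncard (hsub x), ?_⟩
  rw [← Set.ncard_sdiff (hsub x), ← Set.ncard_coe_finset]
  refine Set.ncard_le_ncard fun y hy => ?_
  have hxy : G.Adj x y := hy.1
  simp only [Finset.coe_filter, Finset.mem_univ, true_and, Set.mem_ofPred_eq]
  refine ⟨hxy.ne', Set.ncard_lt_ncard ⟨hsub y, fun h => hy.2 ?_⟩⟩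
  have hyx : (K6C5.map g).Adj y x := h hxy.symm
  exact hyx.symm

theorem not_potentiallyK6C5_of_mem {l : List ℕ}
    (hl : l ∈ ([[5, 5, 3, 3, 3, 3], [5, 5, 3, 3, 3, 3, 2], [5, 5, 3, 3, 3, 3, 3, 3],
      [5, 5, 4, 3, 3, 3, 3]] : List (List ℕ))) : ¬ PotentiallyK6C5 l := by
  intro h
  have := h.exists_copy
  clear h
  revert this
  simp only [List.mem_cons, List.not_mem_nil, or_false] at hl
  rcases hl with rfl | rfl | rfl | rfl <;> decide +kernel

theorem lemma28 (n i j : ℕ) (hn : 6 ≤ n) (hij : 4 ≤ i + j) (hijn : i + j ≤ n - 2)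
    (heven : Even ((List.replicate 2 5 ++ List.replicate i 4 ++ List.replicate j 3 ++
        List.replicate (n - 2 - i - j) 2).sum)) :
    PotentiallyK6C5 (List.replicate 2 5 ++ List.replicate i 4 ++ List.replicate j 3 ++
        List.replicate (n - 2 - i - j) 2) ↔
      (List.replicate 2 5 ++ List.replicate i 4 ++ List.replicate j 3 ++
        List.replicate (n - 2 - i - j) 2) ∉
        ([[5, 5, 3, 3, 3, 3], [5, 5, 3, 3, 3, 3, 2], [5, 5, 3, 3, 3, 3, 3, 3],
          [5, 5, 4, 3, 3, 3, 3]] : List (List ℕ)) := by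
  refine ⟨fun h hmem => not_potentiallyK6C5_of_mem hmem h, fun hmem => ?_⟩
  generalize n - 2 - i - j = k at *
  have hj : Even j := by
    simp only [List.sum_append, List.sum_replicate, smul_eq_mul] at heven
    grind
  have hr : Realizable (degs i j k) := by
    refine realizable_degs hj hij ?_ ?_ ?_ ?_ <;>
    · rintro ⟨rfl, rfl, rfl⟩
      exact hmem (by decide)
  exact Realizable.potentiallyK6C5 hr
end

section
/- If π = (d1, d2, 3^{n−2}) where d1 ≥ d2, d1 ≥ 5, d2 ≥ 3, d1 ≤ n − 1, n ≥ 6 and σ(π) is even, then π is a graphic sequence. -/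
/-- A list is graphic as soon as a relation `S` on `ℕ`, contained in `<`, has symmetrization
whose neighbourhoods among the positions of the list have the prescribed sizes. -/
theorem IsGraphic.of_rel (l : List ℕ) (S : ℕ → ℕ → Prop) (hS : ∀ i j, S i j → i < j)
    (h : ∀ i (hi : i < l.length), ∃ T : Finset ℕ, T.card = l[i] ∧
      ∀ j, j ∈ T ↔ j < l.length ∧ (S i j ∨ S j i)) : IsGraphic l := by
  refine ⟨{ Adj := fun i j => S i j ∨ S j i
            symm := ⟨fun _ _ => Or.symm⟩
            loopless := ⟨fun i hi => ?_⟩ }, fun i => ?_⟩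
  · rcases hi with hi | hi <;> exact lt_irrefl _ (hS _ _ hi)
  · obtain ⟨T, hT, hmem⟩ := h i i.2
    rw [List.get_eq_getElem, ← hT, ← Set.ncard_coe_finset]
    refine Set.ncard_congr (fun j _ => (j : ℕ)) (fun j hj => ?_) (fun _ _ _ _ => Fin.ext)
      (fun j hj => ?_)
    · exact Finset.mem_coe.2 ((hmem j).2 ⟨j.2, hj⟩)
    · obtain ⟨hj, hadj⟩ := (hmem j).1 hj
      exact ⟨⟨j, hj⟩, hadj, rfl⟩

theorem IsGraphic.cons_cons_replicate_three (d₁ d₂ m : ℕ) (S : ℕ → ℕ → Prop)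
    (hS : ∀ i j, S i j → i < j)
    (h₁ : ∃ T : Finset ℕ, T.card = d₁ ∧ ∀ j, j ∈ T ↔ j < m + 2 ∧ (S 0 j ∨ S j 0))
    (h₂ : ∃ T : Finset ℕ, T.card = d₂ ∧ ∀ j, j ∈ T ↔ j < m + 2 ∧ (S 1 j ∨ S j 1))
    (h₃ : ∀ i, 2 ≤ i → i < m + 2 → ∃ x y z, x < y ∧ y < z ∧
      ∀ j, (j = x ∨ j = y ∨ j = z) ↔ j < m + 2 ∧ (S i j ∨ S j i)) :
    IsGraphic (d₁ :: d₂ :: List.replicate m 3) := by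
  refine IsGraphic.of_rel _ S hS fun i hi => ?_
  have hlen : (d₁ :: d₂ :: List.replicate m 3).length = m + 2 := by simp
  match i with
  | 0 => rw [hlen]; exact h₁
  | 1 => rw [hlen]; exact h₂
  | i + 2 =>
    obtain ⟨x, y, z, hxy, hyz, h⟩ := h₃ (i + 2) (by omega) (hlen ▸ hi)
    refine ⟨{x, y, z}, ?_, fun j => by simpa [hlen] using h j⟩
    rw [Finset.card_eq_three.2 ⟨x, y, z, by omega, by omega, by omega, rfl⟩]
    simp

/-- The cycle on `2, …, m + 1` with `k` disjoint edges removed, together with the adjacent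
vertices `0` and `1`, both joined to the ends of the removed edges and sharing out the others. -/
theorem isGraphic_of_le_add (a b m k : ℕ) (hm : 3 ≤ m) (ha : a ≤ m) (hb : b ≤ m)
    (hk : a + b = m + 2 * k) :
    IsGraphic ((a + 1) :: (b + 1) :: List.replicate m 3) := by
  refine IsGraphic.cons_cons_replicate_three _ _ m (fun i j =>
    (i = 0 ∧ j = 1) ∨ (i = 0 ∧ 2 ≤ j ∧ j < a + 2) ∨
    (i = 1 ∧ (2 ≤ j ∧ j < 2 * k + 2 ∨ a + 2 ≤ j)) ∨
    (2 ≤ i ∧ j = i + 1 ∧ ¬ (i % 2 = 0 ∧ i < 2 * k + 2)) ∨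
    (i = 2 ∧ j = m + 1)) (fun i j => by grind) ?_ ?_ ?_
  · exact ⟨Finset.Ico 1 (a + 2), by simp, fun j => by rw [Finset.mem_Ico]; omega⟩
  · refine ⟨insert 0 (Finset.Ico 2 (2 * k + 2) ∪ Finset.Ico (a + 2) (m + 2)), ?_, fun j => ?_⟩
    · rw [Finset.card_insert_of_notMem (by simp), Finset.card_union_of_disjoint]
      · simp; omega
      · rw [Finset.disjoint_left]; intro x; simp only [Finset.mem_Ico]; omega
    · simp only [Finset.mem_insert, Finset.mem_union, Finset.mem_Ico]; grind
  · intro i hi him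
    by_cases hik : i < 2 * k + 2
    · by_cases he : i % 2 = 0
      · by_cases h2 : i = 2
        · exact ⟨0, 1, m + 1, by omega, by omega, fun j => by grind⟩
        · exact ⟨0, 1, i - 1, by omega, by omega, fun j => by grind⟩
      · by_cases h2 : i = m + 1
        · exact ⟨0, 1, 2, by omega, by omega, fun j => by grind⟩
        · exact ⟨0, 1, i + 1, by omega, by omega, fun j => by grind⟩
    · obtain ⟨c, hc, hc'⟩ : ∃ c, c < 2 ∧ (c = 0 ↔ i < a + 2) := by
        by_cases h : i < a + 2
        · exact ⟨0, by omega, by omega⟩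
        · exact ⟨1, by omega, by omega⟩
      by_cases h2 : i = 2
      · exact ⟨c, 3, m + 1, by omega, by omega, fun j => by grind⟩
      · by_cases h3 : i = m + 1
        · exact ⟨c, 2, m, by omega, by omega, fun j => by grind⟩
        · exact ⟨c, i - 1, i + 1, by omega, by omega, fun j => by grind⟩

/-- The cycle on `2, …, m + 1` with `h` disjoint chords added, together with the adjacent
vertices `0` and `1`, which share out the vertices that are not ends of these chords. -/
theorem isGraphic_of_add_lt (a b m h : ℕ) (ha : 2 ≤ a) (hb : 1 ≤ b) (hh : 1 ≤ h)
    (hm : a + b + 2 * h = m) :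
    IsGraphic ((a + 1) :: (b + 1) :: List.replicate m 3) := by
  refine IsGraphic.cons_cons_replicate_three _ _ m (fun i j =>
    (i = 0 ∧ j = 1) ∨ (i = 0 ∧ (j = h + 2 ∨ 2 * h + 3 ≤ j ∧ j < 2 * h + a + 2)) ∨
    (i = 1 ∧ 2 * h + a + 2 ≤ j) ∨ (2 ≤ i ∧ j = i + 1) ∨ (i = 2 ∧ j = m + 1) ∨
    (2 ≤ i ∧ i < h + 2 ∧ j = i + h + 1)) (fun i j => by grind) ?_ ?_ ?_
  · refine ⟨insert 1 (insert (h + 2) (Finset.Ico (2 * h + 3) (2 * h + a + 2))), ?_, fun j => ?_⟩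
    · rw [Finset.card_insert_of_notMem (by simp), Finset.card_insert_of_notMem (by simp; omega)]
      simp; omega
    · simp only [Finset.mem_insert, Finset.mem_Ico]; grind
  · refine ⟨insert 0 (Finset.Ico (2 * h + a + 2) (m + 2)), ?_, fun j => ?_⟩
    · rw [Finset.card_insert_of_notMem (by simp)]
      simp; omega
    · simp only [Finset.mem_insert, Finset.mem_Ico]; grind
  · intro i hi him
    by_cases h1 : i < h + 2
    · by_cases h2 : i = 2
      · exact ⟨3, h + 3, m + 1, by omega, by omega, fun j => by grind⟩
      · exact ⟨i - 1, i + 1, i + h + 1, by omega, by omega, fun j => by grind⟩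
    by_cases h2 : i = h + 2
    · exact ⟨0, i - 1, i + 1, by omega, by omega, fun j => by grind⟩
    by_cases h3 : i < 2 * h + 3
    · exact ⟨i - h - 1, i - 1, i + 1, by omega, by omega, fun j => by grind⟩
    obtain ⟨c, hc, hc'⟩ : ∃ c, c < 2 ∧ (c = 0 ↔ i < 2 * h + a + 2) := by
      by_cases h : i < 2 * h + a + 2
      · exact ⟨0, by omega, by omega⟩
      · exact ⟨1, by omega, by omega⟩
    by_cases h4 : i = m + 1
    · exact ⟨1, 2, m, by omega, by omega, fun j => by grind⟩
    · exact ⟨c, i - 1, i + 1, by omega, by omega, fun j => by grind⟩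

theorem lemma210_1 (n d1 d2 : ℕ) (hn : 6 ≤ n) (h12 : d2 ≤ d1) (hd1 : 5 ≤ d1)
    (hd2 : 3 ≤ d2) (hd1n : d1 ≤ n - 1)
    (heven : Even ((d1 :: d2 :: List.replicate (n - 2) 3).sum)) :
    IsGraphic (d1 :: d2 :: List.replicate (n - 2) 3) := by
  obtain ⟨a, rfl⟩ : ∃ a, d1 = a + 1 := ⟨d1 - 1, by omega⟩
  obtain ⟨b, rfl⟩ : ∃ b, d2 = b + 1 := ⟨d2 - 1, by omega⟩
  obtain ⟨m, rfl⟩ : ∃ m, n = m + 2 := ⟨n - 2, by omega⟩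
  simp only [Nat.add_sub_cancel, List.sum_cons, List.sum_replicate, smul_eq_mul,
    Nat.even_iff] at heven ⊢
  by_cases h : m ≤ a + b
  · exact isGraphic_of_le_add a b m ((a + b - m) / 2) (by omega) (by omega) (by omega) (by omega)
  · exact isGraphic_of_add_lt a b m ((m - a - b) / 2) (by omega) (by omega) (by omega) (by omega)
end

section
/- Let π = (d1, d2, 3^{n−2}) where d1 ≥ d2, d1 ≥ 5, d2 ≥ 3, d1 ≤ n − 1, n ≥ 6 and σ(π) is even. Then π is potentially K6−C5-graphic provided that all of the following hold: (i) if n ≥ 7 and n is even, then π ≠ ((n−1)^2, 3^{n−2}) and π ≠ ((n−2)^2, 3^{n−2}); (ii) if n ≥ 7 and n is odd, then π ≠ (n−1, n−2, 3^{n−2}); (iii) π is none of (5, 3^7), (5, 4, 3^5), (5, 4, 3^7), (5^2, 3^4), (5^2, 3^6), (6, 3^6), (6, 3^8), (7, 3^7), (6, 4, 3^6). -/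
/-- The graph joining each point moved by an involution to its image. -/
def involutionGraph {V : Type*} (f : V → V) (hf : Function.Involutive f) : SimpleGraph V where
  Adj i j := f i = j ∧ i ≠ j
  symm := ⟨fun i j h => ⟨by rw [← h.1, hf i], h.2.symm⟩⟩
  loopless := ⟨fun _ h => h.2 rfl⟩

lemma involutionGraph_ncard {V : Type*} [DecidableEq V] (f : V → V)
    (hf : Function.Involutive f) (i : V) :
    {j | (involutionGraph f hf).Adj i j}.ncard = if f i = i then 0 else 1 := by
  split_ifs with h
  · have : {j | (involutionGraph f hf).Adj i j} = ∅ := by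
      ext j
      simp only [involutionGraph, Set.mem_ofPred_eq, Set.mem_empty_iff_false, iff_false]
      rintro ⟨h1, h2⟩
      exact h2 (h.symm.trans h1)
    rw [this, Set.ncard_empty]
  · have : {j | (involutionGraph f hf).Adj i j} = {f i} := by
      ext j
      simp only [involutionGraph, Set.mem_ofPred_eq, Set.mem_singleton_iff]
      constructor
      · exact fun h => h.1.symm
      · rintro rfl
        exact ⟨rfl, fun h' => h h'.symm⟩
    rw [this, Set.ncard_singleton]

lemma cycleGraph_ncard {m : ℕ} (hm : 3 ≤ m) (i : Fin m) :
    {j | (SimpleGraph.cycleGraph m).Adj i j}.ncard = 2 := by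
  obtain ⟨k, rfl⟩ : ∃ k, m = k + 3 := ⟨m - 3, by omega⟩
  have h := SimpleGraph.cycleGraph_degree_three_le (v := i)
  rw [← SimpleGraph.card_neighborSet_eq_degree, ← Nat.card_eq_fintype_card] at h
  exact h

lemma cycleGraph_adj_iff_val {m : ℕ} (hm : 2 ≤ m) (i j : Fin m) :
    (SimpleGraph.cycleGraph m).Adj i j ↔
      i.val + 1 = j.val ∨ j.val + 1 = i.val ∨ (i.val = 0 ∧ j.val + 1 = m) ∨
        (j.val = 0 ∧ i.val + 1 = m) := by
  rw [SimpleGraph.cycleGraph_adj', Fin.sub_def, Fin.sub_def]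
  have hi := i.isLt
  have hj := j.isLt
  have key : ∀ x y : ℕ, x < m → y < m →
      ((m - y + x) % m = 1 ↔ (y + 1 = x ∨ (x = 0 ∧ y + 1 = m))) := by
    intro x y hx hy
    rcases le_or_gt y x with h | h
    · rw [show m - y + x = (x - y) + m by omega, Nat.add_mod_right, Nat.mod_eq_of_lt (by omega)]
      omega
    · rw [Nat.mod_eq_of_lt (by omega)]
      omega
  simp only [key _ _ hi hj, key _ _ hj hi]
  tauto

/-- `m` vertices can be joined to each other and to two further nonadjacent vertices, of degrees
`a` and `b`, so that all of them have degree 3. -/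
def IsCubicExtension (m a b : ℕ) : Prop :=
  ∃ (R : SimpleGraph (Fin m)) (A B : Finset (Fin m)), A.card = a ∧ B.card = b ∧
    ∀ i, {j | R.Adj i j}.ncard + (if i ∈ A then 1 else 0) + (if i ∈ B then 1 else 0) = 3

lemma isCubicExtension_of_le {m a b : ℕ} (hm : 3 ≤ m) (hm' : 4 ≤ m ∨ m = a + b)
    (hab : a + b ≤ m) (he : Even (a + b + m)) : IsCubicExtension m a b := by
  obtain ⟨k, hk⟩ : ∃ k, m = a + b + 2 * k := ⟨(m - a - b) / 2, by
    rcases he with ⟨r, hr⟩; omega⟩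
  set h := m / 2 with hh
  let g : ℕ → ℕ := fun x =>
    if x < k then x + h else if h ≤ x ∧ x < h + k then x - h else x
  have hg : ∀ x < m, g x < m := by
    intro x hx
    dsimp only [g]
    split_ifs <;> omega
  let f : Fin m → Fin m := fun i => ⟨g i, hg i i.isLt⟩
  have hf : Function.Involutive f := by
    intro i
    apply Fin.ext
    dsimp only [f, g]
    split_ifs <;> omega
  have hfix : ∀ i, f i = i ↔ ¬ (i.val < k ∨ (h ≤ i.val ∧ i.val < h + k)) := by
    intro i
    rw [Fin.ext_iff]
    dsimp only [f, g]
    split_ifs <;> omega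
  have hcard : (Finset.univ.filter fun i => f i = i).card = a + b := by
    have h1 : (Finset.univ.filter fun i => f i = i).card =
        ((Finset.range m).filter
          fun x => ¬ (x < k ∨ (h ≤ x ∧ x < h + k))).card := by
      rw [← Finset.card_map Fin.valEmbedding]
      congr 1
      ext x
      simp only [Finset.mem_map, Finset.mem_filter, Finset.mem_univ, true_and, hfix,
        Fin.valEmbedding_apply, Finset.mem_range]
      constructor
      · rintro ⟨i, hi, rfl⟩
        exact ⟨i.isLt, hi⟩
      · rintro ⟨hx, hi⟩
        exact ⟨⟨x, hx⟩, hi, rfl⟩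
    have h2 : (Finset.range m).filter (fun x => ¬ (x < k ∨ (h ≤ x ∧ x < h + k))) =
        Finset.Ico k h ∪ Finset.Ico (h + k) m := by
      ext x
      simp only [Finset.mem_filter, Finset.mem_range, Finset.mem_union, Finset.mem_Ico]
      omega
    rw [h1, h2, Finset.card_union_of_disjoint, Nat.card_Ico, Nat.card_Ico]
    · omega
    · rw [Finset.disjoint_left]
      intro x
      simp only [Finset.mem_Ico]
      omega
  obtain ⟨A, hA, hAc⟩ := Finset.exists_subset_card_eq
    (s := Finset.univ.filter fun i => f i = i) (n := a) (by omega)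
  refine ⟨SimpleGraph.cycleGraph m ⊔ involutionGraph f hf, A,
    (Finset.univ.filter fun i => f i = i) \ A, hAc, ?_, ?_⟩
  · rw [Finset.card_sdiff_of_subset hA]
    omega
  · intro i
    have hdeg : {j | (SimpleGraph.cycleGraph m ⊔ involutionGraph f hf).Adj i j}.ncard =
        2 + if f i = i then 0 else 1 := by
      rw [← cycleGraph_ncard hm i, ← involutionGraph_ncard f hf i, ← Set.ncard_union_eq]
      · rfl
      · rw [Set.disjoint_left]
        intro j hj hj'
        simp only [Set.mem_ofPred_eq] at hj hj'
        rw [cycleGraph_adj_iff_val (by omega)] at hj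
        obtain ⟨h1, h2⟩ := hj'
        have h3 : ¬ f i = i := fun h' => h2 (h'.symm.trans h1)
        rw [hfix] at h3
        rw [Fin.ext_iff] at h1
        dsimp only [f, g] at h1
        have := j.isLt
        split_ifs at h1 <;> omega
    rw [hdeg]
    have h3 : i ∈ A → f i = i := fun h => (Finset.mem_filter.1 (hA h)).2
    by_cases h1 : f i = i <;> by_cases h2 : i ∈ A <;> first
      | exact absurd (h3 h2) h1
      | simp [h1, h2]

lemma isCubicExtension_of_ge {m a b : ℕ} (hm : 3 ≤ m) (ha : a ≤ m) (hb : b ≤ m)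
    (hab : m ≤ a + b) (he : Even (a + b + m)) : IsCubicExtension m a b := by
  obtain ⟨k, hk⟩ : ∃ k, a + b = m + 2 * k := ⟨(a + b - m) / 2, by
    rcases he with ⟨r, hr⟩; omega⟩
  let g : ℕ → ℕ := fun x =>
    if x < 2 * k then if x % 2 = 0 then x + 1 else x - 1 else x
  have hg : ∀ x < m, g x < m := by
    intro x hx
    dsimp only [g]
    split_ifs <;> omega
  let f : Fin m → Fin m := fun i => ⟨g i, hg i i.isLt⟩
  have hf : Function.Involutive f := by
    intro i
    apply Fin.ext
    dsimp only [f, g]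
    split_ifs <;> omega
  have hfix : ∀ i, f i = i ↔ 2 * k ≤ i.val := by
    intro i
    rw [Fin.ext_iff]
    dsimp only [f, g]
    split_ifs <;> omega
  have hcard : (Finset.univ.filter fun i => f i = i).card = m - 2 * k := by
    rw [← Finset.card_map Fin.valEmbedding, ← Nat.card_Ico]
    congr 1
    ext x
    simp only [Finset.mem_map, Finset.mem_filter, Finset.mem_univ, true_and, hfix,
      Fin.valEmbedding_apply, Finset.mem_Ico]
    constructor
    · rintro ⟨i, hi, rfl⟩
      exact ⟨hi, i.isLt⟩
    · rintro ⟨hi, hx⟩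
      exact ⟨⟨x, hx⟩, hi, rfl⟩
  obtain ⟨A, hA, hAc⟩ := Finset.exists_subset_card_eq
    (s := Finset.univ.filter fun i => f i = i) (n := m - a) (by omega)
  refine ⟨SimpleGraph.cycleGraph m \ involutionGraph f hf, Aᶜ,
    ((Finset.univ.filter fun i => f i = i) \ A)ᶜ, ?_, ?_, ?_⟩
  · rw [Finset.card_compl, Fintype.card_fin]
    omega
  · rw [Finset.card_compl, Fintype.card_fin, Finset.card_sdiff_of_subset hA]
    omega
  · intro i
    have hdeg : {j | (SimpleGraph.cycleGraph m \ involutionGraph f hf).Adj i j}.ncard =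
        2 - if f i = i then 0 else 1 := by
      rw [← cycleGraph_ncard hm i, ← involutionGraph_ncard f hf i, ← Set.ncard_sdiff]
      · rfl
      · intro j hj
        simp only [Set.mem_ofPred_eq] at hj ⊢
        rw [cycleGraph_adj_iff_val (by omega)]
        obtain ⟨h1, h2⟩ := hj
        have h3 : ¬ f i = i := fun h' => h2 (h'.symm.trans h1)
        rw [hfix] at h3
        rw [Fin.ext_iff] at h1
        dsimp only [f, g] at h1
        have := j.isLt
        split_ifs at h1 <;> omega
    rw [hdeg]
    have h3 : i ∈ A → f i = i := fun h => (Finset.mem_filter.1 (hA h)).2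
    by_cases h1 : f i = i <;> by_cases h2 : i ∈ A <;> first
      | exact absurd (h3 h2) h1
      | simp [h1, h2]

instance inst_s8 : DecidableRel K6C5.Adj := fun a b => by
  unfold K6C5
  infer_instance

lemma K6C5_ncard (x : Fin 6) : {y | K6C5.Adj x y}.ncard = if x = 0 then 5 else 3 := by
  have h : {y | K6C5.Adj x y} = ((Finset.univ.filter fun y => K6C5.Adj x y : Finset (Fin 6)) :
      Set (Fin 6)) := by
    ext y
    simp
  rw [h, Set.ncard_coe_finset]
  clear h
  revert x
  decide

/-- The graph obtained from disjoint copies of `K₆ − C₅` and `R` by joining vertex `0` to `A` and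
vertex `1` to `B`. -/
def attachK6C5 {m : ℕ} (R : SimpleGraph (Fin m)) (A B : Finset (Fin m)) :
    SimpleGraph (Fin 6 ⊕ Fin m) where
  Adj
    | .inl x, .inl y => K6C5.Adj x y
    | .inl x, .inr i => (x = 0 ∧ i ∈ A) ∨ (x = 1 ∧ i ∈ B)
    | .inr i, .inl x => (x = 0 ∧ i ∈ A) ∨ (x = 1 ∧ i ∈ B)
    | .inr i, .inr j => R.Adj i j
  symm := ⟨by
    rintro (x | i) (y | j) h
    · exact K6C5.adj_symm h
    · exact h
    · exact h
    · exact R.adj_symm h⟩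
  loopless := ⟨by
    rintro (x | i) h
    · exact K6C5.irrefl h
    · exact R.irrefl h⟩

lemma ncard_sum {α β : Type*} [Finite α] [Finite β] (S : Set (α ⊕ β)) :
    S.ncard = {x | Sum.inl x ∈ S}.ncard + {y | Sum.inr y ∈ S}.ncard := by
  rw [← Set.ncard_image_of_injective {x | Sum.inl x ∈ S} (Sum.inl_injective (β := β)),
    ← Set.ncard_image_of_injective {y | Sum.inr y ∈ S} (Sum.inr_injective (α := α)),
    ← Set.ncard_union_eq]
  · congr 1
    ext (x | y) <;> simp
  · rw [Set.disjoint_left]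
    rintro _ ⟨x, _, rfl⟩ ⟨y, _, h⟩
    cases h

lemma attachK6C5_ncard_inl {m : ℕ} (R : SimpleGraph (Fin m)) (A B : Finset (Fin m)) (x : Fin 6) :
    {w | (attachK6C5 R A B).Adj (.inl x) w}.ncard =
      if x = 0 then 5 + A.card else if x = 1 then 3 + B.card else 3 := by
  rw [ncard_sum]
  change {y | K6C5.Adj x y}.ncard + {i | (x = 0 ∧ i ∈ A) ∨ (x = 1 ∧ i ∈ B)}.ncard = _
  rw [K6C5_ncard]
  split_ifs with h0 h1
  · subst h0
    simp
  · subst h1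
    simp
  · simp [h0, h1]

lemma attachK6C5_ncard_inr {m : ℕ} (R : SimpleGraph (Fin m)) (A B : Finset (Fin m)) (i : Fin m) :
    {w | (attachK6C5 R A B).Adj (.inr i) w}.ncard =
      {j | R.Adj i j}.ncard + (if i ∈ A then 1 else 0) + (if i ∈ B then 1 else 0) := by
  rw [ncard_sum]
  change {x : Fin 6 | (x = 0 ∧ i ∈ A) ∨ (x = 1 ∧ i ∈ B)}.ncard + {j | R.Adj i j}.ncard = _
  have h : {x : Fin 6 | (x = 0 ∧ i ∈ A) ∨ (x = 1 ∧ i ∈ B)}.ncard =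
      (if i ∈ A then 1 else 0) + (if i ∈ B then 1 else 0) := by
    by_cases hA : i ∈ A <;> by_cases hB : i ∈ B <;> simp only [hA, hB, and_true, and_false,
      or_false, false_or, if_true, if_false]
    · exact Set.ncard_pair (a := (0 : Fin 6)) (b := 1) (by decide)
    · exact Set.ncard_singleton (0 : Fin 6)
    · exact Set.ncard_singleton (1 : Fin 6)
    · exact Set.ncard_empty _
  omega

lemma potentiallyK6C5_of_isCubicExtension {m a b : ℕ} (h : IsCubicExtension m a b) :
    PotentiallyK6C5 ((5 + a) :: (3 + b) :: List.replicate (m + 4) 3) := by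
  obtain ⟨R, A, B, rfl, rfl, hR⟩ := h
  set l := (5 + A.card) :: (3 + B.card) :: List.replicate (m + 4) 3 with hl
  have hlen : 6 + m = l.length := by
    simp [hl]
    omega
  let e : Fin 6 ⊕ Fin m ≃ Fin l.length := finSumFinEquiv.trans (finCongr hlen)
  have hinl : ∀ x : Fin 6, (e (.inl x)).val = x.val := fun x => rfl
  have hinr : ∀ i : Fin m, (e (.inr i)).val = 6 + i.val := fun i => rfl
  have hget : ∀ i : Fin l.length, l.get i =
      if i.val = 0 then 5 + A.card else if i.val = 1 then 3 + B.card else 3 := by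
    rintro ⟨_ | _ | i, hi⟩ <;> simp [hl]
  refine ⟨(attachK6C5 R A B).comap e.symm, ?_, fun x => e (.inl x),
    e.injective.comp Sum.inl_injective, ?_⟩
  · intro i
    obtain ⟨w, rfl⟩ := e.surjective i
    have hdeg : degCount ((attachK6C5 R A B).comap e.symm) (e w) =
        {w' | (attachK6C5 R A B).Adj w w'}.ncard := by
      rw [degCount, ← Set.ncard_image_of_injective _ e.symm.injective]
      congr 1
      ext w'
      simp only [SimpleGraph.comap_adj, Equiv.symm_apply_apply, Set.mem_image, Set.mem_ofPred_eq]
      constructor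
      · rintro ⟨j, hj, rfl⟩
        exact hj
      · exact fun h => ⟨e w', by simpa using h, by simp⟩
    rw [hdeg, hget]
    rcases w with x | i
    · rw [attachK6C5_ncard_inl, hinl]
      simp only [Fin.ext_iff]
      rfl
    · rw [attachK6C5_ncard_inr, hR, hinr, if_neg (by omega), if_neg (by omega)]
  · intro x y hxy
    simpa [SimpleGraph.comap_adj] using (show (attachK6C5 R A B).Adj (.inl x) (.inl y) from hxy)

theorem lemma210_2 (n d1 d2 : ℕ) (hn : 6 ≤ n) (h12 : d2 ≤ d1) (hd1 : 5 ≤ d1)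
    (hd2 : 3 ≤ d2) (hd1n : d1 ≤ n - 1)
    (heven : Even ((d1 :: d2 :: List.replicate (n - 2) 3).sum))
    (hi : 7 ≤ n → Even n →
      (d1 :: d2 :: List.replicate (n - 2) 3) ≠ (n - 1) :: (n - 1) :: List.replicate (n - 2) 3 ∧
      (d1 :: d2 :: List.replicate (n - 2) 3) ≠ (n - 2) :: (n - 2) :: List.replicate (n - 2) 3)
    (hii : 7 ≤ n → Odd n →
      (d1 :: d2 :: List.replicate (n - 2) 3) ≠ (n - 1) :: (n - 2) :: List.replicate (n - 2) 3)
    (hiii : (d1 :: d2 :: List.replicate (n - 2) 3) ∉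
      ([[5, 3, 3, 3, 3, 3, 3, 3], [5, 4, 3, 3, 3, 3, 3], [5, 4, 3, 3, 3, 3, 3, 3, 3],
        [5, 5, 3, 3, 3, 3], [5, 5, 3, 3, 3, 3, 3, 3], [6, 3, 3, 3, 3, 3, 3],
        [6, 3, 3, 3, 3, 3, 3, 3, 3], [7, 3, 3, 3, 3, 3, 3, 3],
        [6, 4, 3, 3, 3, 3, 3, 3]] : List (List ℕ))) :
    PotentiallyK6C5 (d1 :: d2 :: List.replicate (n - 2) 3) := by
  obtain ⟨m, rfl⟩ : ∃ m, n = m + 6 := ⟨n - 6, by omega⟩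
  obtain ⟨a, rfl⟩ : ∃ a, d1 = 5 + a := ⟨d1 - 5, by omega⟩
  obtain ⟨b, rfl⟩ : ∃ b, d2 = 3 + b := ⟨d2 - 3, by omega⟩
  rw [show m + 6 - 2 = m + 4 by omega] at *
  have he : Even (a + b + m) := by
    simp only [List.sum_cons, List.sum_replicate, smul_eq_mul] at heven
    rw [Nat.even_iff] at heven ⊢
    omega
  apply potentiallyK6C5_of_isCubicExtension
  have ha : a ≤ m := by omega
  have hb : b ≤ m := by
    by_contra hlt
    rw [Nat.even_iff] at he
    simp only [ne_eq, List.cons.injEq, and_true] at hi hii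
    rcases Nat.eq_zero_or_pos m with rfl | hm
    · obtain rfl : a = 0 := by omega
      obtain rfl : b = 2 := by omega
      exact hiii (by decide)
    · rcases Nat.even_or_odd (m + 6) with hpar | hpar
      · have := hi (by omega) hpar
        rw [Nat.even_iff] at hpar
        omega
      · have := hii (by omega) hpar
        rw [Nat.odd_iff] at hpar
        omega
  rcases Nat.lt_or_ge m 3 with hm | hm
  · interval_cases m
    · refine ⟨⊥, ∅, ∅, ?_, ?_, fun i => i.elim0⟩ <;> simp <;> omega
    · interval_cases a <;> interval_cases b <;> first
        | exact absurd he (by decide)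
        | exact absurd (by decide) hiii
    · interval_cases a <;> interval_cases b <;> first
        | exact absurd he (by decide)
        | exact absurd (by decide) hiii
        | skip
      refine ⟨⊤, Finset.univ, Finset.univ, by simp, by simp, fun i => ?_⟩
      have h : {j | (⊤ : SimpleGraph (Fin 2)).Adj i j} = {i + 1} := by
        ext j
        revert i j
        simp only [SimpleGraph.top_adj, Set.mem_ofPred_eq, Set.mem_singleton_iff]
        decide
      rw [h, Set.ncard_singleton]
      simp
  · rcases le_total m (a + b) with hab | hab
    · exact isCubicExtension_of_ge hm ha hb hab he
    · refine isCubicExtension_of_le hm ?_ hab he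
      by_contra hcon
      obtain rfl : m = 3 := by omega
      have hab' : a + b = 1 := by
        rw [Nat.even_iff] at he
        omega
      obtain ⟨rfl, rfl⟩ | ⟨rfl, rfl⟩ : (a = 0 ∧ b = 1) ∨ (a = 1 ∧ b = 0) := by omega
      · exact hiii (by decide)
      · exact hiii (by decide)
end

section
/- If π = (d1, 3^5, 2^{n−6}) where d1 ≥ 5, d1 ≤ n − 1, n ≥ 6 and σ(π) is even, then π is a graphic sequence. -/
/-- Adjacency, from the smaller to the larger endpoint, in a hub `0` joined to `1, …, 5` and to all
vertices beyond `k`, a cycle on `1, …, k`, and a perfect matching on the vertices beyond `k`. -/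
def hubCycleMatchingRel (k a b : ℕ) : Prop :=
  (a = 0 ∧ (1 ≤ b ∧ b ≤ 5 ∨ k < b)) ∨ (1 ≤ a ∧ b = a + 1 ∧ b ≤ k) ∨ (a = 1 ∧ b = k) ∨
    (k < a ∧ b = a + 1 ∧ (a - k) % 2 = 1)

/-- The graph on `Fin n` whose edges are given by `hubCycleMatchingRel k`. -/
def hubCycleMatching (n k : ℕ) : SimpleGraph (Fin n) :=
  SimpleGraph.fromRel fun a b => hubCycleMatchingRel k a b

theorem degCount_eq_card {n : ℕ} (G : SimpleGraph (Fin n)) (i : Fin n) (S : Finset ℕ)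
    (hlt : ∀ x ∈ S, x < n) (hS : ∀ j : Fin n, G.Adj i j ↔ (j : ℕ) ∈ S) :
    degCount G i = S.card := by
  have h : Set.image Fin.val {j | G.Adj i j} = (S : Set ℕ) := by
    ext x
    constructor
    · rintro ⟨j, hj, rfl⟩
      exact (hS j).1 hj
    · intro hx
      exact ⟨⟨x, hlt x hx⟩, (hS _).2 hx, rfl⟩
  rw [degCount, ← Set.ncard_image_of_injective _ Fin.val_injective, h, Set.ncard_coe_finset]

theorem degCount_hubCycleMatching {n k : ℕ} (hk : 5 ≤ k) (hkn : k < n)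
    (hpar : (n - 1 - k) % 2 = 0) (i : Fin n) :
    degCount (hubCycleMatching n k) i =
      if (i : ℕ) = 0 then n + 4 - k else if (i : ℕ) ≤ 5 then 3 else 2 := by
  obtain ⟨i, hi⟩ := i
  have key (S : Finset ℕ) (hlt : ∀ x ∈ S, x < n)
      (hS : ∀ x < n, (i ≠ x ∧ (hubCycleMatchingRel k i x ∨ hubCycleMatchingRel k x i)) ↔ x ∈ S) :
      degCount (hubCycleMatching n k) ⟨i, hi⟩ = S.card := by
    refine degCount_eq_card _ _ S hlt fun j => ?_
    rw [← hS j j.2]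
    simp [hubCycleMatching, Fin.ext_iff]
  have pair (a b : ℕ) (hab : a ≠ b) : ({a, b} : Finset ℕ).card = 2 := Finset.card_pair hab
  have triple (a b c : ℕ) (hab : a ≠ b) (hac : a ≠ c) (hbc : b ≠ c) :
      ({a, b, c} : Finset ℕ).card = 3 := Finset.card_eq_three.2 ⟨a, b, c, hab, hac, hbc, rfl⟩
  simp only
  by_cases h0 : i = 0
  · rw [key (Finset.Icc 1 5 ∪ Finset.Ioo k n)]
    · rw [Finset.card_union_of_disjoint]
      · simp [h0]; omega
      · rw [Finset.disjoint_left]; intro x; simp only [Finset.mem_Icc, Finset.mem_Ioo]; omega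
    · intro x; simp only [Finset.mem_union, Finset.mem_Icc, Finset.mem_Ioo]; omega
    · intro x hx
      simp only [Finset.mem_union, Finset.mem_Icc, Finset.mem_Ioo, hubCycleMatchingRel]; omega
  rw [if_neg h0]
  by_cases h5 : i ≤ 5
  · rw [if_pos h5, key {0, if i = 1 then k else i - 1, if i = k then 1 else i + 1}]
    · apply triple <;> split_ifs <;> omega
    · intro x; simp only [Finset.mem_insert, Finset.mem_singleton]; split_ifs <;> omega
    · intro x hx
      simp only [Finset.mem_insert, Finset.mem_singleton, hubCycleMatchingRel]
      split_ifs <;> omega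
  rw [if_neg h5]
  by_cases hik : i ≤ k
  · rw [key {i - 1, if i = k then 1 else i + 1}]
    · apply pair; split_ifs <;> omega
    · intro x; simp only [Finset.mem_insert, Finset.mem_singleton]; split_ifs <;> omega
    · intro x hx
      simp only [Finset.mem_insert, Finset.mem_singleton, hubCycleMatchingRel]
      split_ifs <;> omega
  · rw [key {0, if (i - k) % 2 = 1 then i + 1 else i - 1}]
    · apply pair; split_ifs <;> omega
    · intro x; simp only [Finset.mem_insert, Finset.mem_singleton]; split_ifs <;> omega
    · intro x hx
      simp only [Finset.mem_insert, Finset.mem_singleton, hubCycleMatchingRel]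
      split_ifs <;> omega

theorem lemma211_1 (n d1 : ℕ) (hn : 6 ≤ n) (hd1 : 5 ≤ d1) (hd1n : d1 ≤ n - 1)
    (heven : Even ((d1 :: (List.replicate 5 3 ++ List.replicate (n - 6) 2)).sum)) :
    IsGraphic (d1 :: (List.replicate 5 3 ++ List.replicate (n - 6) 2)) := by
  have hodd : d1 % 2 = 1 := by
    rw [Nat.even_iff, List.sum_cons, List.sum_append, List.sum_replicate, List.sum_replicate,
      smul_eq_mul, smul_eq_mul] at heven
    omega
  have hlen : (d1 :: (List.replicate 5 3 ++ List.replicate (n - 6) 2)).length = n := by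
    simp only [List.length_cons, List.length_append, List.length_replicate]
    omega
  refine ⟨hubCycleMatching _ (n + 4 - d1), fun i => ?_⟩
  rw [degCount_hubCycleMatching (by omega) (by omega) (by omega)]
  obtain ⟨i, hi⟩ := i
  rw [List.get_eq_getElem]
  rcases i with _ | i
  · simp only [List.getElem_cons_zero, if_true]
    omega
  · simp only [List.getElem_cons_succ, List.getElem_append, List.getElem_replicate,
      List.length_replicate]
    rw [if_neg (Nat.succ_ne_zero i)]
    split_ifs <;> omega
end

section
/- For every n ≥ 7, the sequence π = (n−1, 3^6, 1^{n−7}) (one term equal to n−1, six terms equal to 3, and n−7 terms equal to 1) is not potentially K6−C5-graphic. -/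
open Finset in
lemma card_le_degCount {m : ℕ} {G : SimpleGraph (Fin m)} {v : Fin m} (s : Finset (Fin m))
    (hs : ∀ j ∈ s, G.Adj v j) : #s ≤ degCount G v := by
  rw [degCount, ← Set.ncard_coe_finset]
  exact Set.ncard_le_ncard (fun j hj => hs j hj) (Set.toFinite _)

/-- A vertex whose degree is one less than the order of the graph is adjacent to all others. -/
lemma adj_of_degCount_eq {m : ℕ} {G : SimpleGraph (Fin m)} {v : Fin m}
    (hv : degCount G v = m - 1) {j : Fin m} (hj : j ≠ v) : G.Adj v j := by
  have hsub : {j | G.Adj v j} ⊆ ({v}ᶜ : Set (Fin m)) := fun j hj => hj.ne'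
  have hcard : ({v}ᶜ : Set (Fin m)).ncard ≤ {j | G.Adj v j}.ncard := by
    rw [Set.ncard_compl, Set.ncard_singleton, Nat.card_eq_fintype_card, Fintype.card_fin]
    exact hv.ge
  have heq := Set.eq_of_subset_of_ncard_le hsub hcard (Set.toFinite _)
  exact (Set.ext_iff.mp heq j).mpr hj

lemma K6C5_zero_adj {i : Fin 6} (hi : i ≠ 0) : K6C5.Adj 0 i := by
  simp [K6C5, hi.symm]

/-- Every vertex of the 5-cycle in `K₆ − C₅` has two neighbours on that cycle. -/
lemma K6C5_exists_adj_adj {i : Fin 6} (hi : i ≠ 0) :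
    ∃ a b : Fin 6, a ≠ 0 ∧ b ≠ 0 ∧ a ≠ b ∧ K6C5.Adj i a ∧ K6C5.Adj i b := by
  simp only [K6C5, SimpleGraph.fromRel_adj]
  fin_cases i
  · exact absurd rfl hi
  · exact ⟨3, 4, by decide⟩
  · exact ⟨4, 5, by decide⟩
  · exact ⟨1, 5, by decide⟩
  · exact ⟨1, 2, by decide⟩
  · exact ⟨2, 3, by decide⟩

open Finset in
/-- No copy of `K₆ − C₅` has its centre `f 0` adjacent to all other vertices when, apart from the
centre, the graph has exactly six vertices of degree `3` and all others have degree at most `1`. -/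
lemma false_of_K6C5_embedding {m : ℕ} {G : SimpleGraph (Fin m)} {f : Fin 6 → Fin m}
    (hf : Function.Injective f) (hG : ∀ a b, K6C5.Adj a b → G.Adj (f a) (f b))
    (hdom : ∀ j, j ≠ f 0 → G.Adj (f 0) j) {s : Finset (Fin m)} (hs : #s = 6) (h0 : f 0 ∉ s)
    (hthree : ∀ v ∈ s, degCount G v = 3)
    (hone : ∀ v, v ≠ f 0 → v ∉ s → degCount G v ≤ 1) : False := by
  classical
  have hmem : ∀ i, i ≠ 0 → f i ∈ s := by
    intro i hi
    by_contra his
    obtain ⟨a, b, -, -, hab, hia, hib⟩ := K6C5_exists_adj_adj hi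
    have h := card_le_degCount (G := G) (v := f i) {f a, f b} (by
      simp [hG _ _ hia, hG _ _ hib])
    rw [card_pair (hf.ne hab)] at h
    have := hone _ (hf.ne hi) his
    omega
  set c : Finset (Fin m) := ((univ : Finset (Fin 6)).erase 0).image f with hc
  have hccard : #c = 5 := by
    rw [hc, card_image_of_injective _ hf]
    rfl
  have hcs : c ⊆ s := by
    intro v hv
    obtain ⟨i, hi, rfl⟩ := mem_image.mp hv
    exact hmem i (ne_of_mem_erase hi)
  obtain ⟨w, hw⟩ := card_eq_one.mp (show #(s \ c) = 1 by
    rw [card_sdiff_of_subset hcs, hs, hccard])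
  have hws : w ∈ s ∧ w ∉ c := by
    rw [← mem_sdiff, hw]
    exact mem_singleton_self w
  have hnbr : {j | G.Adj w j} ⊆ {f 0} := by
    intro j (hj : G.Adj w j)
    by_contra hj0
    have hj0 : j ≠ f 0 := hj0
    have hw0 : w ≠ f 0 := fun h => h0 (h ▸ hws.1)
    have hjs : j ∈ s := by
      by_contra hjs
      have h := card_le_degCount (G := G) (v := j) {f 0, w} (by
        simp [(hdom j hj0).symm, hj.symm])
      rw [card_pair hw0.symm] at h
      have := hone j hj0 hjs
      omega
    have hjc : j ∈ c := by
      by_contra hjc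
      have : j ∈ s \ c := mem_sdiff.mpr ⟨hjs, hjc⟩
      rw [hw, mem_singleton] at this
      exact hj.ne' this
    obtain ⟨i, hi, rfl⟩ := mem_image.mp hjc
    obtain ⟨a, b, ha, hb, hab, hia, hib⟩ := K6C5_exists_adj_adj (ne_of_mem_erase hi)
    have hwc : ∀ k, k ≠ 0 → w ≠ f k := by
      rintro k hk rfl
      exact hws.2 (mem_image_of_mem f (mem_erase.mpr ⟨hk, mem_univ k⟩))
    have h := card_le_degCount (G := G) (v := f i) {w, f 0, f a, f b} (by
      simp [(hdom _ hj0).symm, hj.symm, hG _ _ hia, hG _ _ hib])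
    have h4 : #({w, f 0, f a, f b} : Finset (Fin m)) = 4 := by
      rw [card_insert_of_notMem, card_insert_of_notMem, card_pair (hf.ne hab)]
      · simp [hf.eq_iff, ha.symm, hb.symm]
      · simp [hw0, hwc a ha, hwc b hb]
    have := hthree _ hjs
    omega
  have h := Set.ncard_le_ncard hnbr (Set.toFinite _)
  rw [Set.ncard_singleton] at h
  have := hthree w hws.1
  rw [degCount] at this
  omega

theorem cond7_necessary_1 (n : ℕ) (hn : 7 ≤ n) :
    ¬ PotentiallyK6C5 ((n - 1) :: (List.replicate 6 3 ++ List.replicate (n - 7) 1)) := by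
  generalize hl : (n - 1) :: (List.replicate 6 3 ++ List.replicate (n - 7) 1) = l
  rintro ⟨G, hdeg, f, hf, hG⟩
  have hlen : l.length = n := by
    simp [← hl]
    omega
  have hzero : ∀ v : Fin l.length, v.val = 0 → degCount G v = l.length - 1 := by
    intro v hv
    rw [hdeg, hlen]
    simp [← hl, hv]
  have hthree : ∀ v : Fin l.length, v.val ≠ 0 → v.val ≤ 6 → degCount G v = 3 := by
    intro v hv hv6
    obtain ⟨k, hk⟩ := Nat.exists_eq_succ_of_ne_zero hv
    rw [hdeg]
    simp only [← hl, List.get_eq_getElem, hk, Nat.succ_eq_add_one, List.getElem_cons_succ]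
    rw [List.getElem_append_left (by simp; omega), List.getElem_replicate]
  have hone : ∀ v : Fin l.length, 6 < v.val → degCount G v = 1 := by
    intro v hv6
    obtain ⟨k, hk⟩ := Nat.exists_eq_succ_of_ne_zero (show v.val ≠ 0 by omega)
    rw [hdeg]
    simp only [← hl, List.get_eq_getElem, hk, Nat.succ_eq_add_one, List.getElem_cons_succ]
    rw [List.getElem_append_right (by simp; omega), List.getElem_replicate]
  have hf0 : (f 0).val = 0 := by
    by_contra h0
    have h := card_le_degCount (G := G) (v := f 0)
      (((Finset.univ : Finset (Fin 6)).erase 0).image f) (by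
        intro j hj
        obtain ⟨i, hi, rfl⟩ := Finset.mem_image.mp hj
        exact hG _ _ (K6C5_zero_adj (Finset.ne_of_mem_erase hi)))
    rw [Finset.card_image_of_injective _ hf, Finset.card_erase_of_mem (Finset.mem_univ _),
      Finset.card_univ, Fintype.card_fin] at h
    rcases le_or_gt (f 0).val 6 with h6 | h6
    · have := hthree _ h0 h6
      omega
    · have := hone _ h6
      omega
  refine false_of_K6C5_embedding hf hG (fun j hj => adj_of_degCount_eq (hzero _ hf0) hj)
    (s := Finset.Ioc (f 0) ⟨6, by omega⟩) ?_ (by simp) ?_ ?_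
  · simp [hf0]
  · intro v hv
    rw [Finset.mem_Ioc, Fin.lt_def, Fin.le_def] at hv
    exact hthree v (by omega) hv.2
  · intro v hv hvs
    rw [Finset.mem_Ioc, Fin.lt_def, Fin.le_def] at hvs
    have : v.val ≠ (f 0).val := fun h => hv (Fin.ext h)
    exact (hone v (by simp only [] at hvs; omega)).le
end

section
/- For every n ≥ 8, the sequence π = (n−1, 3^7, 1^{n−8}) (one term equal to n−1, seven terms equal to 3, and n−8 terms equal to 1) is not potentially K6−C5-graphic. -/
lemma card_le_degCount_s16 {n : ℕ} {G : SimpleGraph (Fin n)} {v : Fin n} {T : Finset (Fin n)}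
    (h : ∀ x ∈ T, G.Adj v x) : T.card ≤ degCount G v := by
  rw [degCount, ← Set.ncard_coe_finset]
  exact Set.ncard_le_ncard (fun x hx => h x hx) (Set.toFinite _)

lemma degCount_le_card {n : ℕ} {G : SimpleGraph (Fin n)} {v : Fin n} {T : Finset (Fin n)}
    (h : ∀ x, G.Adj v x → x ∈ T) : degCount G v ≤ T.card := by
  rw [degCount, ← Set.ncard_coe_finset]
  exact Set.ncard_le_ncard (fun x hx => h x hx) (Set.toFinite _)

/-- A vertex of degree `n - 1` is adjacent to all other vertices. -/
lemma adj_of_degCount_eq_s16 {n : ℕ} {G : SimpleGraph (Fin n)} {v w : Fin n}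
    (h : degCount G v = n - 1) (hw : v ≠ w) : G.Adj v w := by
  by_contra hadj
  have hle : degCount G v ≤ ((Finset.univ.erase v).erase w).card :=
    degCount_le_card fun x hx => by
      simp only [Finset.mem_erase, Finset.mem_univ, and_true]
      exact ⟨fun e => hadj (e ▸ hx), hx.ne'⟩
  rw [Finset.card_erase_of_mem (by simpa using hw.symm),
    Finset.card_erase_of_mem (Finset.mem_univ _), Finset.card_fin] at hle
  have hv := v.isLt
  have hw' := w.isLt
  have := Fin.val_ne_of_ne hw
  omega

lemma K6C5_adj_zero {j : Fin 6} (hj : j ≠ 0) : K6C5.Adj 0 j := by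
  simp [K6C5, hj.symm]

lemma exists_three_K6C5_adj (i : Fin 6) :
    ∃ T : Finset (Fin 6), T.card = 3 ∧ ∀ j ∈ T, K6C5.Adj i j := by
  have h : ∀ i : Fin 6, ∃ T : Finset (Fin 6), T.card = 3 ∧ ∀ j ∈ T, i ≠ j ∧
      ((i = 0 ∨ j = 0 ∨
        (i, j) ∈ ([(1, 3), (3, 5), (5, 2), (2, 4), (4, 1)] : List (Fin 6 × Fin 6))) ∨
      (j = 0 ∨ i = 0 ∨
        (j, i) ∈ ([(1, 3), (3, 5), (5, 2), (2, 4), (4, 1)] : List (Fin 6 × Fin 6)))) := by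
    decide
  obtain ⟨T, hT, hadj⟩ := h i
  exact ⟨T, hT, fun j hj => (SimpleGraph.fromRel_adj _ _ _).mpr (hadj j hj)⟩

lemma not_exists_K6C5_of_degCount {n : ℕ} {G : SimpleGraph (Fin n)} (hn : 8 ≤ n)
    (h_zero : ∀ i : Fin n, i.val = 0 → degCount G i = n - 1)
    (h_mid : ∀ i : Fin n, 1 ≤ i.val → i.val ≤ 7 → degCount G i = 3)
    (h_end : ∀ i : Fin n, 8 ≤ i.val → degCount G i = 1)
    (f : Fin 6 → Fin n) (hf : Function.Injective f)
    (hadj : ∀ a b, K6C5.Adj a b → G.Adj (f a) (f b)) : False := by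
  have three_le : ∀ i, 3 ≤ degCount G (f i) := fun i => by
    obtain ⟨T, hT, hT'⟩ := exists_three_K6C5_adj i
    rw [← hT, ← Finset.card_image_of_injective T hf]
    refine card_le_degCount_s16 fun x hx => ?_
    obtain ⟨j, hj, rfl⟩ := Finset.mem_image.mp hx
    exact hadj _ _ (hT' j hj)
  have five_le : 5 ≤ degCount G (f 0) := by
    have hc : ((Finset.univ.erase (0 : Fin 6)).image f).card = 5 := by
      rw [Finset.card_image_of_injective _ hf]
      decide
    refine hc.ge.trans (card_le_degCount_s16 fun x hx => ?_)
    obtain ⟨j, hj, rfl⟩ := Finset.mem_image.mp hx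
    exact hadj _ _ (K6C5_adj_zero (Finset.ne_of_mem_erase hj))
  have f_zero : (f 0).val = 0 := by
    by_contra h
    by_cases h7 : (f 0).val ≤ 7
    · have := h_mid _ (by omega) h7
      omega
    · have := h_end (f 0) (by omega)
      omega
  have f_mid : ∀ i, i ≠ 0 → 1 ≤ (f i).val ∧ (f i).val ≤ 7 := fun i hi => by
    have hne : (f i).val ≠ (f 0).val := Fin.val_ne_of_ne (hf.ne hi)
    have h3 := three_le i
    by_contra h
    have := h_end (f i) (by omega)
    omega
  have hub : ∀ w, f 0 ≠ w → G.Adj (f 0) w := fun w => adj_of_degCount_eq_s16 (h_zero _ f_zero)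
  set S : Finset (Fin n) := Finset.Icc ⟨1, by omega⟩ ⟨7, by omega⟩ with hS
  have mem_S : ∀ x : Fin n, x ∈ S ↔ 1 ≤ x.val ∧ x.val ≤ 7 := fun x => by
    simp [hS, Fin.le_def]
  set R := (Finset.univ.erase (0 : Fin 6)).image f with hR
  have hRS : R ⊆ S := fun x hx => by
    obtain ⟨j, hj, rfl⟩ := Finset.mem_image.mp hx
    exact (mem_S _).mpr (f_mid j (Finset.ne_of_mem_erase hj))
  have hcard : (S \ R).card = 2 := by
    rw [Finset.card_sdiff_of_subset hRS, hR, Finset.card_image_of_injective _ hf,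
      hS, Fin.card_Icc]
    rfl
  obtain ⟨u, hu⟩ : (S \ R).Nonempty := Finset.card_pos.mp (by omega)
  obtain ⟨huS, huR⟩ := Finset.mem_sdiff.mp hu
  obtain ⟨hu1, hu7⟩ := (mem_S u).mp huS
  have hu0 : f 0 ≠ u := fun e => by rw [e] at f_zero; omega
  have hnbr : ∀ x, G.Adj u x → x ∈ insert (f 0) ((S \ R).erase u) := fun x hx => by
    by_cases hx0 : x = f 0
    · simp [hx0]
    refine Finset.mem_insert_of_mem (Finset.mem_erase.mpr ⟨hx.ne', Finset.mem_sdiff.mpr ⟨?_, ?_⟩⟩)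
    · rw [mem_S]
      have hxv : x.val ≠ (f 0).val := Fin.val_ne_of_ne hx0
      by_contra h
      have hd := h_end x (by omega)
      have hle : ({f 0, u} : Finset (Fin n)).card ≤ degCount G x := card_le_degCount_s16 fun y hy => by
        rcases Finset.mem_insert.mp hy with rfl | hy
        · exact (hub x (Ne.symm hx0)).symm
        · exact Finset.mem_singleton.mp hy ▸ hx.symm
      rw [Finset.card_pair hu0] at hle
      omega
    · intro hxR
      obtain ⟨i, hi, rfl⟩ := Finset.mem_image.mp hxR
      obtain ⟨h1, h7⟩ := f_mid i (Finset.ne_of_mem_erase hi)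
      obtain ⟨T, hT, hT'⟩ := exists_three_K6C5_adj i
      have huT : u ∉ T.image f := fun h => by
        obtain ⟨j, -, rfl⟩ := Finset.mem_image.mp h
        refine huR (Finset.mem_image_of_mem f (Finset.mem_erase.mpr ⟨?_, Finset.mem_univ _⟩))
        rintro rfl
        exact hu0 rfl
      have hle : (insert u (T.image f)).card ≤ degCount G (f i) := card_le_degCount_s16 fun y hy => by
        rcases Finset.mem_insert.mp hy with rfl | hy
        · exact hx.symm
        · obtain ⟨j, hj, rfl⟩ := Finset.mem_image.mp hy
          exact hadj _ _ (hT' j hj)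
      rw [Finset.card_insert_of_notMem huT, Finset.card_image_of_injective _ hf, hT,
        h_mid _ h1 h7] at hle
      omega
  have hle := (degCount_le_card hnbr).trans (Finset.card_insert_le _ _)
  rw [h_mid u hu1 hu7, Finset.card_erase_of_mem hu, hcard] at hle
  omega

theorem cond7_necessary_2 (n : ℕ) (hn : 8 ≤ n) :
    ¬ PotentiallyK6C5 ((n - 1) :: (List.replicate 7 3 ++ List.replicate (n - 8) 1)) := by
  rintro ⟨G, hG, f, hf, hadj⟩
  have hlen : ((n - 1) :: (List.replicate 7 3 ++ List.replicate (n - 8) 1)).length = n := by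
    simp only [List.length_cons, List.length_append, List.length_replicate]
    omega
  refine not_exists_K6C5_of_degCount (by omega) (fun i hi => ?_) (fun i h1 h7 => ?_)
    (fun i h8 => ?_) f hf hadj
  · rw [hG, hlen]
    simp [List.get_eq_getElem, hi]
  · rw [hG, List.get_eq_getElem, List.getElem_cons, dif_neg (by omega),
      List.getElem_append_left (by simp only [List.length_replicate]; omega),
      List.getElem_replicate]
  · rw [hG, List.get_eq_getElem, List.getElem_cons, dif_neg (by omega),
      List.getElem_append_right (by simp only [List.length_replicate]; omega),
      List.getElem_replicate]
end
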